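/- Let X be a compact Ptolemy space with properties (E) and (I), and let ω ∈ X. Then for any two Ptolemy lines l, l' ⊆ X_ω, every Busemann function of l is an affine function along l': for every unit-speed parameterization c' : ℝ → X_ω of l' there exist α, β ∈ ℝ such that b(c'(t)) = α·t + β for all t ∈ ℝ, where b is any Busemann function of l. -/

import Mathlib

open scoped ENNReal

namespace Mobius

/-- An extended metric on `X`, allowed to have (at most) one infinitely remote point,
which is recorded in the field `rem`.  Distances take values in `ℝ≥0∞`, and the value `⊤`
occurs exactly on pairs of distinct points one of which is the remote point. -/
structure ExtMetric (X : Type*) where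
  d : X → X → ℝ≥0∞
  rem : Option X
  symm : ∀ x y, d x y = d y x
  d_self : ∀ x, d x x = 0
  pos : ∀ x y, x ≠ y → 0 < d x y
  triangle : ∀ x y z, d x z ≤ d x y + d y z
  d_eq_top_iff : ∀ x y, d x y = ⊤ ↔ (x ≠ y ∧ (rem = some x ∨ rem = some y))

/-- The finite factor of a distance used in cross-ratio triples: infinite factors are
dropped (replaced by `1`), in accordance with the standard conventions for cross-ratio
triples of quadruples containing the infinitely remote point. -/
noncomputable def ExtMetric.fd {X : Type*} (d : ExtMetric X) (x y : X) : ℝ :=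
  if d.d x y = ⊤ then 1 else (d.d x y).toReal

/-- A representative in `ℝ³` of the cross-ratio triple
`crt(x,y,z,u) = (d(x,y)d(z,u) : d(x,z)d(y,u) : d(x,u)d(y,z)) ∈ ℝP²`,
with the standard conventions when the infinitely remote point occurs among the points. -/
noncomputable def crtVec {X : Type*} (d : ExtMetric X) (x y z u : X) : ℝ × ℝ × ℝ :=
  (d.fd x y * d.fd z u, d.fd x z * d.fd y u, d.fd x u * d.fd y z)

/-- A quadruple is admissible if no entry occurs three or four times in it. -/
def Admissible {X : Type*} (x y z u : X) : Prop :=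
  ¬(x = y ∧ y = z) ∧ ¬(x = y ∧ y = u) ∧ ¬(x = z ∧ z = u) ∧ ¬(y = z ∧ z = u)

/-- Two vectors in `ℝ³` represent the same point of the projective plane (they are
positively proportional). -/
def ProjEq (v w : ℝ × ℝ × ℝ) : Prop :=
  ∃ lam : ℝ, 0 < lam ∧ w = lam • v

theorem ProjEq.refl (v : ℝ × ℝ × ℝ) : ProjEq v v :=
  ⟨1, one_pos, (one_smul ℝ v).symm⟩

theorem ProjEq.symm {v w : ℝ × ℝ × ℝ} (h : ProjEq v w) : ProjEq w v := by
  obtain ⟨l, hl, rfl⟩ := h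
  exact ⟨l⁻¹, inv_pos.mpr hl, by rw [smul_smul, inv_mul_cancel₀ hl.ne', one_smul]⟩

theorem ProjEq.trans' {v w u : ℝ × ℝ × ℝ} (h1 : ProjEq v w) (h2 : ProjEq v u) :
    ProjEq w u := by
  obtain ⟨l, hl, rfl⟩ := h1
  obtain ⟨m, hm, rfl⟩ := h2
  refine ⟨m * l⁻¹, by positivity, ?_⟩
  rw [smul_smul, mul_assoc, inv_mul_cancel₀ hl.ne', mul_one]

/-- A Möbius structure on a set `X`: a (maximal) class of pairwise Möbius-equivalent
extended metrics on `X`, i.e. metrics defining the same cross-ratio triples on all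
admissible quadruples. -/
structure MobiusStructure (X : Type*) where
  M : Set (ExtMetric X)
  nonempty : M.Nonempty
  compat : ∀ d ∈ M, ∀ d' ∈ M, ∀ x y z u : X, Admissible x y z u →
    ProjEq (crtVec d x y z u) (crtVec d' x y z u)
  maximal : ∀ d' : ExtMetric X,
    (∀ d ∈ M, ∀ x y z u : X, Admissible x y z u →
      ProjEq (crtVec d x y z u) (crtVec d' x y z u)) → d' ∈ M

/-- The Möbius structure generated by a single extended metric. -/
def MobiusStructure.ofMetric {X : Type*} (d₀ : ExtMetric X) : MobiusStructure X where
  M := {d | ∀ x y z u : X, Admissible x y z u →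
    ProjEq (crtVec d₀ x y z u) (crtVec d x y z u)}
  nonempty := ⟨d₀, fun _ _ _ _ _ => ProjEq.refl _⟩
  compat := fun _ hd _ hd' x y z u ha => (hd x y z u ha).trans' (hd' x y z u ha)
  maximal := fun _ h => h d₀ (fun _ _ _ _ _ => ProjEq.refl _)

/-- A Möbius structure is Ptolemy if the entries of every cross-ratio triple of every
admissible quadruple satisfy the triangle inequality. -/
def IsPtolemyStructure {X : Type*} (S : MobiusStructure X) : Prop :=
  ∀ d ∈ S.M, ∀ x y z u : X, Admissible x y z u →
    (crtVec d x y z u).1 ≤ (crtVec d x y z u).2.1 + (crtVec d x y z u).2.2 ∧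
    (crtVec d x y z u).2.1 ≤ (crtVec d x y z u).1 + (crtVec d x y z u).2.2 ∧
    (crtVec d x y z u).2.2 ≤ (crtVec d x y z u).1 + (crtVec d x y z u).2.1

/-- The topology of a Möbius space: generated by the open balls of the metrics of the
structure (centered at points distinct from the respective remote points) together with
the complements of the closed balls. -/
def mobiusTop {X : Type*} (S : MobiusStructure X) : TopologicalSpace X :=
  TopologicalSpace.generateFrom
    {s | ∃ d ∈ S.M, ∃ x : X, d.rem ≠ some x ∧ ∃ r : ℝ≥0∞, 0 < r ∧ r ≠ ⊤ ∧
      (s = {y | d.d y x < r} ∨ s = {y | r < d.d y x})}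

/-- Connected components of subsets with respect to the Möbius topology. -/
def mobiusCCIn {X : Type*} (S : MobiusStructure X) (F : Set X) (x : X) : Set X :=
  @connectedComponentIn X (mobiusTop S) F x

/-- The pair `(x,z)` separates the pair `(y,u)` in `σ`:  `y` and `u` lie in different
connected components of `σ \ {x,z}`. -/
def SeparatesIn {X : Type*} (S : MobiusStructure X) (σ : Set X) (x z y u : X) : Prop :=
  u ∉ mobiusCCIn S (σ \ {x, z}) y

/-- `σ` is homeomorphic to the circle `S¹` (with respect to the Möbius topology). -/
def HomeoToCircle {X : Type*} (S : MobiusStructure X) (σ : Set X) : Prop :=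
  letI : TopologicalSpace X := mobiusTop S
  Nonempty (σ ≃ₜ Metric.sphere (0 : ℂ) 1)

/-- `X` is homeomorphic to the sphere `Sⁿ ⊆ ℝ^{n+1}` (w.r.t. the Möbius topology). -/
def HomeoToSphere {X : Type*} (S : MobiusStructure X) (n : ℕ) : Prop :=
  letI : TopologicalSpace X := mobiusTop S
  Nonempty (X ≃ₜ Metric.sphere (0 : EuclideanSpace ℝ (Fin (n + 1))) 1)

/-- The subset `A ⊆ X` is homeomorphic to `ℝᵖ` (w.r.t. the Möbius topology). -/
def SubsetHomeoToEuclidean {X : Type*} (S : MobiusStructure X) (A : Set X) (p : ℕ) : Prop :=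
  letI : TopologicalSpace X := mobiusTop S
  Nonempty (A ≃ₜ EuclideanSpace ℝ (Fin p))

/-- The subset `A ⊆ X` is homeomorphic to `ℝ` (w.r.t. the Möbius topology). -/
def SubsetHomeoToReal {X : Type*} (S : MobiusStructure X) (A : Set X) : Prop :=
  letI : TopologicalSpace X := mobiusTop S
  Nonempty (A ≃ₜ ℝ)

/-- A Ptolemy circle: a subset homeomorphic to `S¹` on which the Ptolemy equality holds
for every quadruple of distinct points `(x,y,z,u)` such that `(x,z)` separates `(y,u)`. -/
def IsPtolemyCircle {X : Type*} (S : MobiusStructure X) (σ : Set X) : Prop :=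
  HomeoToCircle S σ ∧
  ∀ d ∈ S.M, ∀ x ∈ σ, ∀ y ∈ σ, ∀ z ∈ σ, ∀ u ∈ σ,
    x ≠ y → x ≠ z → x ≠ u → y ≠ z → y ≠ u → z ≠ u →
    SeparatesIn S σ x z y u →
    d.d x z * d.d y u = d.d x y * d.d z u + d.d x u * d.d y z

/-- A Möbius automorphism of `X`: a bijection preserving all cross-ratio triples. -/
def IsMobiusAuto {X : Type*} (S : MobiusStructure X) (f : X → X) : Prop :=
  Function.Bijective f ∧ ∀ d ∈ S.M, ∀ x y z u : X, Admissible x y z u →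
    ProjEq (crtVec d x y z u) (crtVec d (f x) (f y) (f z) (f u))

/-- A metric sphere between two distinct points `ω`, `ω'`. -/
def IsMetricSphere {X : Type*} (S : MobiusStructure X) (ω ω' : X) (Sp : Set X) : Prop :=
  ∃ d ∈ S.M, d.rem = some ω' ∧ ∃ r : ℝ≥0∞, 0 < r ∧ r ≠ ⊤ ∧ Sp = {x | d.d x ω = r}

/-- A space inversion with respect to `ω`, `ω'` and a metric sphere `Sp` between them. -/
def IsSpaceInversion {X : Type*} (S : MobiusStructure X) (ω ω' : X) (Sp : Set X)
    (φ : X → X) : Prop :=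
  IsMobiusAuto S φ ∧ Function.Involutive φ ∧ (∀ x, φ x ≠ x) ∧ φ ω = ω' ∧
  φ '' Sp = Sp ∧ ∀ σ : Set X, IsPtolemyCircle S σ → ω ∈ σ → ω' ∈ σ → φ '' σ = σ

/-- Property (E): existence of at least one Ptolemy circle. -/
def PropertyE {X : Type*} (S : MobiusStructure X) : Prop :=
  ∃ σ : Set X, IsPtolemyCircle S σ

/-- Property (I): existence and uniqueness of space inversions. -/
def PropertyI {X : Type*} (S : MobiusStructure X) : Prop :=
  ∀ ω ω' : X, ω ≠ ω' → ∀ Sp : Set X, IsMetricSphere S ω ω' Sp →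
    ∃! φ : X → X, IsSpaceInversion S ω ω' Sp φ

/-- The Möbius space is compact. -/
def MobiusCompact {X : Type*} (S : MobiusStructure X) : Prop :=
  letI : TopologicalSpace X := mobiusTop S
  CompactSpace X

/-- Property (H), the homothety property. -/
def PropertyH {X : Type*} (S : MobiusStructure X) : Prop :=
  ∀ ω ω' : X, ω ≠ ω' → ∀ σ : Set X, IsPtolemyCircle S σ → ω ∈ σ → ω' ∈ σ →
    ∀ x x' : X, x ∈ σ \ {ω, ω'} → x' ∈ mobiusCCIn S (σ \ {ω, ω'}) x →
    ∃ γ : X → X, IsMobiusAuto S γ ∧ γ ω = ω ∧ γ ω' = ω' ∧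
      (∀ σ' : Set X, IsPtolemyCircle S σ' → ω ∈ σ' → ω' ∈ σ' →
        γ '' σ' = σ' ∧ ∀ y ∈ σ' \ {ω, ω'}, γ y ∈ mobiusCCIn S (σ' \ {ω, ω'}) y) ∧
      γ x = x'

/-- A Ptolemy line in `X_ω`: a Ptolemy circle through `ω` with `ω` removed. -/
def IsPtolemyLine {X : Type*} (S : MobiusStructure X) (ω : X) (l : Set X) : Prop :=
  ∃ σ : Set X, IsPtolemyCircle S σ ∧ ω ∈ σ ∧ l = σ \ {ω}

/-- `c : ℝ → X` is a unit-speed parameterization of `l ⊆ X` w.r.t. the metric `d`. -/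
def IsUnitSpeed {X : Type*} (d : ExtMetric X) (l : Set X) (c : ℝ → X) : Prop :=
  Set.range c = l ∧ ∀ s t : ℝ, d.d (c s) (c t) = ENNReal.ofReal |s - t|

/-- `b` is a Busemann function of the Ptolemy line `l ⊆ X_ω`:  up to an additive constant,
`b x = lim_{t→∞} (d(x,c(t)) − t)` for a unit-speed parameterization `c` of `l`. -/
def IsBusemannOf {X : Type*} (S : MobiusStructure X) (d : ExtMetric X) (ω : X)
    (l : Set X) (b : X → ℝ) : Prop :=
  IsPtolemyLine S ω l ∧ ∃ c : ℝ → X, IsUnitSpeed d l c ∧ ∃ C : ℝ, ∀ x : X, x ≠ ω →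
    Filter.Tendsto (fun t => (d.d x (c t)).toReal - t) Filter.atTop (nhds (b x + C))

/-- The fiber through `x` of the canonical fibration `π_ω`: the set of points on which
every Busemann function of every Ptolemy line of `X_ω` takes the same value as at `x`. -/
def mobiusFiber {X : Type*} (S : MobiusStructure X) (d : ExtMetric X) (ω : X) (x : X) :
    Set X :=
  {y | y ≠ ω ∧ ∀ (l : Set X) (b : X → ℝ), IsBusemannOf S d ω l b → b y = b x}

/-- The base `B_ω` of the canonical fibration: the set of all fibers. -/
def mobiusBase {X : Type*} (S : MobiusStructure X) (d : ExtMetric X) (ω : X) :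
    Set (Set X) :=
  {F | ∃ x : X, x ≠ ω ∧ F = mobiusFiber S d ω x}

/-- The distance between two fibers. -/
noncomputable def fiberDist {X : Type*} (d : ExtMetric X) (F F' : Set X) : ℝ :=
  sInf {r : ℝ | ∃ x ∈ F, ∃ x' ∈ F', r = (d.d x x').toReal}

/-- Two Möbius spaces are Möbius equivalent: there is a bijection between them
preserving all cross-ratio triples. -/
def MobiusEquiv {X Y : Type*} (S : MobiusStructure X) (S' : MobiusStructure Y) : Prop :=
  ∃ f : X → Y, Function.Bijective f ∧ ∀ d ∈ S.M, ∀ d' ∈ S'.M, ∀ x y z u : X,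
    Admissible x y z u → ProjEq (crtVec d x y z u) (crtVec d' (f x) (f y) (f z) (f u))

/-- The standard extended Euclidean metric on the one-point extension
`ℝ̂ⁿ = ℝⁿ ∪ {∞}`, where `∞` is encoded by `none`. -/
noncomputable def stdExtMetric (n : ℕ) : ExtMetric (Option (EuclideanSpace ℝ (Fin n))) where
  d x y :=
    match x, y with
    | none, none => 0
    | none, some _ => ⊤
    | some _, none => ⊤
    | some a, some b => ENNReal.ofReal (dist a b)
  rem := some none
  symm := by intro x y; cases x <;> cases y <;> simp [dist_comm]
  d_self := by intro x; cases x <;> simp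
  pos := by
    intro x y h
    cases x <;> cases y
    · exact absurd rfl h
    · simp
    · simp
    · simp only [ne_eq, Option.some.injEq] at h
      exact ENNReal.ofReal_pos.mpr (dist_pos.mpr h)
  triangle := by
    intro x y z
    cases x <;> cases y <;> cases z <;>
      simp only [le_refl, le_top, zero_le, zero_add, add_zero, top_add, add_top,
        top_le_iff]
    rw [← ENNReal.ofReal_add dist_nonneg dist_nonneg]
    exact ENNReal.ofReal_le_ofReal (dist_triangle _ _ _)
  d_eq_top_iff := by
    intro x y
    cases x <;> cases y <;>
      simp [ENNReal.ofReal_ne_top]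


/-- The real-valued distance of an extended metric (meaningful off the remote point). -/
noncomputable def ExtMetric.rd {X : Type*} (d : ExtMetric X) (x y : X) : ℝ :=
  (d.d x y).toReal

section RealDistance

variable {X : Type*} {d : ExtMetric X} {ω : X}

theorem ExtMetric.rd_nonneg (x y : X) : 0 ≤ d.rd x y := ENNReal.toReal_nonneg

theorem ExtMetric.rd_comm (x y : X) : d.rd x y = d.rd y x := by
  unfold ExtMetric.rd
  rw [d.symm]

theorem ExtMetric.d_ne_top (hrem : d.rem = some ω) {x y : X} (hx : x ≠ ω) (hy : y ≠ ω) :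
    d.d x y ≠ ⊤ := by
  rw [Ne, d.d_eq_top_iff, hrem]
  rintro ⟨-, h | h⟩
  · exact hx (Option.some.inj h).symm
  · exact hy (Option.some.inj h).symm

theorem ExtMetric.rd_pos (hrem : d.rem = some ω) {x y : X} (hx : x ≠ ω) (hy : y ≠ ω)
    (hxy : x ≠ y) : 0 < d.rd x y :=
  ENNReal.toReal_pos (d.pos x y hxy).ne' (d.d_ne_top hrem hx hy)

theorem ExtMetric.rd_triangle (hrem : d.rem = some ω) {x y z : X} (hx : x ≠ ω) (hy : y ≠ ω)
    (hz : z ≠ ω) : d.rd x z ≤ d.rd x y + d.rd y z := by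
  unfold ExtMetric.rd
  rw [← ENNReal.toReal_add (d.d_ne_top hrem hx hy) (d.d_ne_top hrem hy hz)]
  exact ENNReal.toReal_mono
    (ENNReal.add_ne_top.mpr ⟨d.d_ne_top hrem hx hy, d.d_ne_top hrem hy hz⟩) (d.triangle x y z)

theorem ExtMetric.fd_eq_rd (hrem : d.rem = some ω) {x y : X} (hx : x ≠ ω) (hy : y ≠ ω) :
    d.fd x y = d.rd x y :=
  if_neg (d.d_ne_top hrem hx hy)

theorem ExtMetric.fd_remote_right (hrem : d.rem = some ω) {x : X} (hx : x ≠ ω) :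
    d.fd x ω = 1 :=
  if_pos ((d.d_eq_top_iff x ω).mpr ⟨hx, Or.inr hrem⟩)

theorem ExtMetric.fd_remote_left (hrem : d.rem = some ω) {x : X} (hx : x ≠ ω) :
    d.fd ω x = 1 :=
  if_pos ((d.d_eq_top_iff ω x).mpr ⟨hx.symm, Or.inl hrem⟩)

theorem IsUnitSpeed.rd_eq {l : Set X} {c : ℝ → X} (hc : IsUnitSpeed d l c) (s t : ℝ) :
    d.rd (c s) (c t) = |s - t| := by
  unfold ExtMetric.rd
  rw [hc.2, ENNReal.toReal_ofReal (abs_nonneg _)]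

theorem IsUnitSpeed.ne_remote {l : Set X} {c : ℝ → X} (hc : IsUnitSpeed d l c)
    (hl : ω ∉ l) (t : ℝ) : c t ≠ ω := fun h => hl (hc.1 ▸ ⟨t, h⟩)

theorem IsUnitSpeed.injective {l : Set X} {c : ℝ → X} (hc : IsUnitSpeed d l c) :
    Function.Injective c := by
  intro s t h
  have := hc.rd_eq s t
  rw [h, hc.rd_eq t t, sub_self, abs_zero] at this
  exact sub_eq_zero.mp (abs_eq_zero.mp this.symm)

/-- The distance to a fixed point is convex along a geodesic line of a Ptolemy space. -/
theorem IsPtolemyStructure.rd_convex {S : MobiusStructure X} (hpt : IsPtolemyStructure S)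
    (hd : d ∈ S.M) (hrem : d.rem = some ω) {l : Set X} {c : ℝ → X} (hc : IsUnitSpeed d l c)
    (hl : ω ∉ l) {z : X} (hz : z ≠ ω) {s m t : ℝ} (hsm : s < m) (hmt : m < t) :
    (t - s) * d.rd z (c m) ≤ (t - m) * d.rd z (c s) + (m - s) * d.rd z (c t) := by
  have hne := hc.ne_remote hl
  have hne_c : ∀ {u v : ℝ}, u < v → c u ≠ c v := fun h e => h.ne (hc.injective e)
  have hadm : Admissible (c s) z (c t) (c m) := by
    have h1 := hne_c hsm
    have h2 := hne_c hmt
    have h3 := hne_c (hsm.trans hmt)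
    refine ⟨?_, ?_, ?_, ?_⟩ <;> rintro ⟨e1, e2⟩
    · exact h3 (e1.trans e2)
    · exact h1 (e1.trans e2)
    · exact h3 e1
    · exact h2 e2.symm
  have h := (hpt d hd _ _ _ _ hadm).2.1
  simp only [crtVec] at h
  rw [d.fd_eq_rd hrem (hne s) (hne t), d.fd_eq_rd hrem hz (hne m),
    d.fd_eq_rd hrem (hne s) hz, d.fd_eq_rd hrem (hne t) (hne m),
    d.fd_eq_rd hrem (hne s) (hne m), d.fd_eq_rd hrem hz (hne t),
    hc.rd_eq, hc.rd_eq, hc.rd_eq, abs_of_neg (by linarith), abs_of_pos (by linarith),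
    abs_of_neg (by linarith), d.rd_comm (c s) z] at h
  linarith

end RealDistance

section Inversion

variable {X : Type*} {S : MobiusStructure X} {d : ExtMetric X} {ω : X}

/-- A space inversion with respect to a unit sphere of `X_ω` acts on distances as an
inversion. -/
theorem IsSpaceInversion.rd_mul (hd : d ∈ S.M) (hrem : d.rem = some ω) {p q : X}
    (hp : p ≠ ω) (hq : d.d q p = 1) {φ : X → X}
    (hφ : IsSpaceInversion S p ω {x | d.d x p = 1} φ) {x y : X} (hx : x ≠ ω) (hxp : x ≠ p)
    (hy : y ≠ ω) (hyp : y ≠ p) :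
    φ x ≠ ω ∧ φ x ≠ p ∧ d.rd (φ x) p * d.rd x p = 1 ∧
      d.rd (φ x) (φ y) * (d.rd x p * d.rd y p) = d.rd x y := by
  obtain ⟨⟨hbij, hcr⟩, hinv, -, hpω, hSp, -⟩ := hφ
  have hωp : φ ω = p := by rw [← hpω, hinv]
  have hneω : ∀ {x}, x ≠ p → φ x ≠ ω := fun h e => h (hbij.1 (e.trans hpω.symm))
  have hnep : ∀ {x}, x ≠ ω → φ x ≠ p := fun h e => h (hbij.1 (e.trans hωp.symm))
  have key : ∀ {x y : X}, x ≠ ω → x ≠ p → y ≠ ω → y ≠ p → ∃ k : ℝ, 0 < k ∧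
      d.rd (φ x) (φ y) = k * d.rd x y ∧ d.rd (φ y) p = k * d.rd x p ∧
      d.rd (φ x) p = k * d.rd y p := by
    intro x y hx hxp hy hyp
    have hadm : Admissible x y p ω :=
      ⟨fun h => hyp h.2, fun h => hy h.2, fun h => hp h.2, fun h => hp h.2⟩
    obtain ⟨k, hk, h⟩ := hcr d hd x y p ω hadm
    rw [hpω, hωp] at h
    simp only [crtVec, Prod.smul_mk, smul_eq_mul, Prod.mk.injEq] at h
    rw [d.fd_eq_rd hrem (hneω hxp) (hneω hyp), d.fd_eq_rd hrem hx hy,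
      d.fd_eq_rd hrem (hneω hxp) hp, d.fd_eq_rd hrem (hneω hyp) hp,
      d.fd_eq_rd hrem hx hp, d.fd_eq_rd hrem hy hp,
      d.fd_remote_left hrem hp, d.fd_remote_right hrem hp, d.fd_remote_right hrem hx,
      d.fd_remote_right hrem hy, d.fd_remote_right hrem (hneω hxp),
      d.fd_remote_right hrem (hneω hyp)] at h
    obtain ⟨h1, h2, h3⟩ := h
    exact ⟨k, hk, by linarith, by linarith, by linarith⟩
  have hq1 : d.rd q p = 1 := by simp [ExtMetric.rd, hq]
  have hqp : q ≠ p := by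
    rintro rfl
    rw [d.d_self] at hq
    exact zero_ne_one hq
  have hqω : q ≠ ω := by
    rintro rfl
    rw [(d.d_eq_top_iff q p).mpr ⟨hqp, Or.inl hrem⟩] at hq
    exact ENNReal.top_ne_one hq
  have hφq : d.rd (φ q) p = 1 := by
    have : φ q ∈ {x | d.d x p = 1} := hSp ▸ ⟨q, hq, rfl⟩
    have h : d.d (φ q) p = 1 := this
    simp [ExtMetric.rd, h]
  have hunit : ∀ {x : X}, x ≠ ω → x ≠ p → d.rd (φ x) p * d.rd x p = 1 := by
    intro x hx hxp
    obtain ⟨k, -, -, h2, h3⟩ := key hx hxp hqω hqp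
    rw [hφq] at h2
    rw [h3, hq1, mul_one]
    exact h2.symm
  refine ⟨hneω hxp, hnep hx, hunit hx hxp, ?_⟩
  obtain ⟨k, -, h1, -, h3⟩ := key hx hxp hy hyp
  have := hunit hx hxp
  rw [h3] at this
  rw [h1]
  linear_combination d.rd x y * this

/-- The inversion with respect to a unit sphere centered on a Ptolemy line acts on that line
by the standard inversion of the real line without fixed points. -/
theorem exists_inversion_on_line (hI : PropertyI S) (hd : d ∈ S.M) (hrem : d.rem = some ω)
    {l : Set X} (hl : IsPtolemyLine S ω l) {c : ℝ → X} (hc : IsUnitSpeed d l c) (s : ℝ) :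
    ∃ φ : X → X, Function.Involutive φ ∧
      (∀ x, x ≠ ω → x ≠ c s → φ x ≠ ω ∧ φ x ≠ c s ∧ d.rd (φ x) (c s) * d.rd x (c s) = 1) ∧
      (∀ x y, x ≠ ω → x ≠ c s → y ≠ ω → y ≠ c s →
        d.rd (φ x) (φ y) * (d.rd x (c s) * d.rd y (c s)) = d.rd x y) ∧
      ∀ t ≠ 0, φ (c (s + t)) = c (s - 1 / t) := by
  obtain ⟨σ, hσ, hωσ, rfl⟩ := hl
  have hne := hc.ne_remote (ω := ω) (fun h => h.2 rfl)
  obtain ⟨φ, hφ, -⟩ := hI (c s) ω (hne s) {x | d.d x (c s) = 1}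
    ⟨d, hd, hrem, 1, one_pos, ENNReal.one_ne_top, rfl⟩
  have hq : d.d (c (s + 1)) (c s) = 1 := by simp [hc.2]
  have H := fun {x y : X} => hφ.rd_mul (x := x) (y := y) hd hrem (hne s) hq
  have hmem : ∀ t, c t ∈ σ := fun t => ((hc.1 ▸ ⟨t, rfl⟩ : c t ∈ σ \ {ω})).1
  have hinj : ∀ {t : ℝ}, t ≠ 0 → c (s + t) ≠ c s := fun ht e =>
    ht (by simpa using hc.injective e)
  have himage : ∀ t ≠ 0, φ (c (s + t)) = c (s + 1 / t) ∨ φ (c (s + t)) = c (s - 1 / t) := by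
    intro t ht
    obtain ⟨h1, -, h3, -⟩ := H (hne (s + t)) (hinj ht) (hne (s + t)) (hinj ht)
    have hmσ : φ (c (s + t)) ∈ σ \ {ω} :=
      ⟨hφ.2.2.2.2.2 σ hσ (hmem s) hωσ ▸ ⟨_, hmem _, rfl⟩, h1⟩
    rw [← hc.1] at hmσ
    obtain ⟨v, hv⟩ := hmσ
    rw [← hv, hc.rd_eq, hc.rd_eq, add_sub_cancel_left, ← abs_mul] at h3
    rw [← hv]
    rcases (abs_eq zero_le_one).mp h3 with h | h
    · left; congr 1; field_simp; linarith
    · right; congr 1; field_simp; linarith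
  refine ⟨φ, hφ.2.1, fun x hx hxp => ?_, fun x y hx hxp hy hyp => (H hx hxp hy hyp).2.2.2, ?_⟩
  · obtain ⟨h1, h2, h3, -⟩ := H hx hxp hx hxp
    exact ⟨h1, h2, h3⟩
  have hone : φ (c (s + 1)) = c (s - 1) := by
    rcases himage 1 one_ne_zero with h | h
    · exact absurd (by simpa using h) (hφ.2.2.1 (c (s + 1)))
    · simpa using h
  intro t ht
  rcases himage t ht with h | h
  · exfalso
    obtain ⟨-, -, -, h4⟩ := H (hne (s + t)) (hinj ht) (hne (s + 1)) (hinj one_ne_zero)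
    rw [h, hone, hc.rd_eq, hc.rd_eq, hc.rd_eq, hc.rd_eq, ← abs_mul, ← abs_mul] at h4
    have h5 := (sq_eq_sq_iff_abs_eq_abs _ _).mpr h4
    field_simp at h5
    ring_nf at h5
    exact pow_ne_zero 3 ht (by linarith)
  · exact h

end Inversion

/-- A function whose slopes are nondecreasing and bounded by one cannot have uniformly large
kinks along a strictly increasing sequence. -/
theorem not_forall_kink {f : ℝ → ℝ} (hLip : ∀ s t, |f s - f t| ≤ |s - t|)
    (hconv : ∀ s m t, s < m → m < t → (t - s) * f m ≤ (t - m) * f s + (m - s) * f t)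
    {a : ℕ → ℝ} (ha : StrictMono a) {κ : ℝ} (hκ : 0 < κ)
    (hkink : ∀ n, ∀ u > 0, κ * u ≤ f (a n + u) + f (a n - u) - 2 * f (a n)) : False := by
  set m : ℕ → ℝ := fun n => (f (a (n + 1)) - f (a n)) / (a (n + 1) - a n) with hm
  have hgap : ∀ n, 0 < a (n + 1) - a n := fun n => sub_pos.mpr (ha (Nat.lt_succ_self n))
  have hbound : ∀ n, |m n| ≤ 1 := by
    intro n
    rw [hm, abs_div]
    exact div_le_one_of_le₀ (hLip _ _) (abs_nonneg _)
  have hstep : ∀ n, m n + κ ≤ m (n + 1) := by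
    intro n
    have h1 := hgap n
    have h2 := hgap (n + 1)
    obtain ⟨u, hu, hu1, hu2⟩ : ∃ u, 0 < u ∧ u < a (n + 1) - a n ∧ u < a (n + 2) - a (n + 1) := by
      obtain ⟨u, hu, hu'⟩ := exists_between (lt_min h1 h2)
      exact ⟨u, hu, hu'.trans_le (min_le_left _ _), hu'.trans_le (min_le_right _ _)⟩
    have hr : f (a (n + 1) + u) - f (a (n + 1)) ≤ m (n + 1) * u := by
      have := hconv (a (n + 1)) (a (n + 1) + u) (a (n + 2)) (by linarith) (by linarith)
      simp only [hm]
      rw [div_mul_eq_mul_div, le_div_iff₀ h2]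
      linarith
    have hl : m n * u ≤ f (a (n + 1)) - f (a (n + 1) - u) := by
      have := hconv (a n) (a (n + 1) - u) (a (n + 1)) (by linarith) (by linarith)
      simp only [hm]
      rw [div_mul_eq_mul_div, div_le_iff₀ h1]
      linarith
    have := hkink (n + 1) u hu
    refine le_of_mul_le_mul_right ?_ hu
    linarith
  have hsum : ∀ n : ℕ, m 0 + n * κ ≤ m n := by
    intro n
    induction n with
    | zero => simp
    | succ k ih =>
      push_cast
      linarith [hstep k]
  obtain ⟨n, hn⟩ := exists_nat_gt (2 / κ)
  rw [div_lt_iff₀ hκ] at hn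
  linarith [hsum n, (abs_le.mp (hbound 0)).1, (abs_le.mp (hbound n)).2]

section Flatness

variable {X : Type*} {S : MobiusStructure X} {d : ExtMetric X} {ω : X}

/-- Bounded sequences of `X_ω` accumulate in the metric sense. -/
theorem exists_frequently_rd_lt (hcomp : MobiusCompact S) (hd : d ∈ S.M)
    (hrem : d.rem = some ω) {p : X} (hp : p ≠ ω) {y : ℕ → X} (hy : ∀ n, y n ≠ ω) {R : ℝ}
    (hR : 0 < R) (hyR : ∀ n, d.rd (y n) p ≤ R) :
    ∃ z, z ≠ ω ∧ ∀ δ > 0, ∃ᶠ n in Filter.atTop, d.rd (y n) z < δ := by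
  let : TopologicalSpace X := mobiusTop S
  have : CompactSpace X := hcomp
  have hrne : ∀ {x : X}, x ≠ ω → d.rem ≠ some x := fun h e =>
    h (Option.some.inj (hrem.symm.trans e)).symm
  have hclosed : IsClosed {x | d.d x p ≤ ENNReal.ofReal R} := by
    rw [← isOpen_compl_iff]
    refine TopologicalSpace.isOpen_generateFrom_of_mem
      ⟨d, hd, p, hrne hp, ENNReal.ofReal R, ENNReal.ofReal_pos.mpr hR,
        ENNReal.ofReal_ne_top, Or.inr ?_⟩
    ext x
    simp
  obtain ⟨z, hz, hcl⟩ := hclosed.isCompact.exists_mapClusterPt (f := Filter.atTop) (u := y) (by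
    refine Filter.tendsto_principal.mpr (Filter.Eventually.of_forall fun n => ?_)
    exact (ENNReal.le_ofReal_iff_toReal_le (d.d_ne_top hrem (hy n) hp) hR.le).mpr (hyR n))
  have hzω : z ≠ ω := by
    rintro rfl
    have h : d.d z p ≤ ENNReal.ofReal R := hz
    rw [(d.d_eq_top_iff z p).mpr ⟨hp.symm, Or.inl hrem⟩] at h
    exact ENNReal.ofReal_ne_top (top_le_iff.mp h)
  refine ⟨z, hzω, fun δ hδ => ?_⟩
  have hopen : IsOpen {x | d.d x z < ENNReal.ofReal δ} :=
    TopologicalSpace.isOpen_generateFrom_of_mem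
      ⟨d, hd, z, hrne hzω, ENNReal.ofReal δ, ENNReal.ofReal_pos.mpr hδ,
        ENNReal.ofReal_ne_top, Or.inl rfl⟩
  have hmem : {x | d.d x z < ENNReal.ofReal δ} ∈ nhds z := hopen.mem_nhds (by
    simpa [d.d_self] using hδ)
  exact (hcl.frequently hmem).mono fun n hn =>
    (ENNReal.lt_ofReal_iff_toReal_lt (d.d_ne_top hrem (hy n) hzω)).mp hn

/-- Busemann flatness: opposite Busemann functions of a Ptolemy line add up to zero. -/
theorem busemann_flat (hpt : IsPtolemyStructure S) (hcomp : MobiusCompact S)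
    (hI : PropertyI S) (hd : d ∈ S.M) (hrem : d.rem = some ω) {l : Set X}
    (hl : IsPtolemyLine S ω l) {c : ℝ → X} (hc : IsUnitSpeed d l c) {z : X} (hz : z ≠ ω)
    {β : ℝ} (hβ : 0 < β) : ∃ T, d.rd z (c T) + d.rd z (c (-T)) - 2 * T < β := by
  by_contra! hcon
  have hωl : ω ∉ l := by
    obtain ⟨σ, -, -, rfl⟩ := hl
    exact fun h => h.2 rfl
  have hne := hc.ne_remote hωl
  have hshift : ∀ s T, 2 * T + β ≤ d.rd z (c (s + T)) + d.rd z (c (s - T)) := by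
    intro s T
    have h := hcon (|s| + T)
    have h1 := d.rd_triangle hrem hz (hne (s + T)) (hne (|s| + T))
    have h2 := d.rd_triangle hrem hz (hne (s - T)) (hne (-(|s| + T)))
    rw [hc.rd_eq, abs_of_nonpos (a := s + T - (|s| + T)) (by linarith [le_abs_self s])] at h1
    rw [hc.rd_eq, abs_of_nonneg (a := s - T - -(|s| + T)) (by linarith [neg_abs_le s])] at h2
    linarith
  set a : ℕ → ℝ := fun n => -(1 / ((n : ℝ) + 1)) with ha
  have ha_mono : StrictMono a := fun m n hmn =>
    neg_lt_neg (one_div_lt_one_div_of_lt (by positivity) (by exact_mod_cast Nat.succ_lt_succ hmn))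
  have ha_abs : ∀ n, |a n| ≤ 1 := by
    intro n
    rw [ha, abs_neg, abs_of_nonneg (by positivity)]
    exact div_le_one_of_le₀ (by linarith [(Nat.cast_nonneg n : (0 : ℝ) ≤ n)]) (by positivity)
  set M : ℝ := d.rd z (c 0) + 1 with hM
  have hMpos : 0 < M := by linarith [d.rd_nonneg z (c 0)]
  have hlow : ∀ n, β / 2 ≤ d.rd z (c (a n)) := by
    intro n
    have := hshift (a n) 0
    simp only [add_zero, sub_zero] at this
    linarith
  have hupp : ∀ n, d.rd z (c (a n)) ≤ M := by
    intro n
    have := d.rd_triangle hrem hz (hne 0) (hne (a n))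
    rw [hc.rd_eq, zero_sub, abs_neg] at this
    linarith [ha_abs n]
  have hzc : ∀ n, z ≠ c (a n) := by
    intro n e
    have := hlow n
    rw [← e, ExtMetric.rd, d.d_self, ENNReal.toReal_zero] at this
    linarith
  choose φ hinv hφ hφd hφc using fun n => exists_inversion_on_line hI hd hrem hl hc (a n)
  have hy := fun n => hφ n z hz (hzc n)
  have hy_low : ∀ n, 1 / M ≤ d.rd (φ n z) (c (a n)) := by
    intro n
    have h := (hy n).2.2
    rw [div_le_iff₀ hMpos, ← h]
    exact mul_le_mul_of_nonneg_left (hupp n) (d.rd_nonneg _ _)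
  have hy_upp : ∀ n, d.rd (φ n z) (c (a n)) ≤ 2 / β := by
    intro n
    have h := (hy n).2.2
    have := mul_le_mul_of_nonneg_left (hlow n) (d.rd_nonneg (φ n z) (c (a n)))
    rw [le_div_iff₀ hβ]
    linarith
  obtain ⟨y, hyω, hyfreq⟩ := exists_frequently_rd_lt hcomp hd hrem (hne 0)
    (fun n => (hy n).1) (R := 2 / β + 1) (by positivity) (fun n => by
      have := d.rd_triangle hrem (hy n).1 (hne (a n)) (hne 0)
      rw [hc.rd_eq, sub_zero] at this
      linarith [ha_abs n, hy_upp n])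
  set δ : ℝ := min (1 / (2 * M)) (β / (8 * M ^ 2)) with hδ
  have hδpos : 0 < δ := lt_min (by positivity) (by positivity)
  have hδ1 : δ ≤ 1 / (2 * M) := min_le_left _ _
  have hδ2 : δ ≤ β / (8 * M ^ 2) := min_le_right _ _
  obtain ⟨ψ, hψ, hψδ⟩ := Filter.extraction_of_frequently_atTop (hyfreq δ hδpos)
  refine not_forall_kink (f := fun t => d.rd y (c t)) (a := a ∘ ψ) (κ := β / (4 * M)) ?_
    (fun s m t hsm hmt => hpt.rd_convex hd hrem hc hωl hyω hsm hmt)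
    (ha_mono.comp hψ) (by positivity) ?_
  · intro s t
    have h1 := d.rd_triangle hrem hyω (hne s) (hne t)
    have h2 := d.rd_triangle hrem hyω (hne t) (hne s)
    rw [hc.rd_eq] at h1 h2
    rw [abs_sub_comm] at h2
    exact abs_le.mpr ⟨by linarith, by linarith⟩
  intro n u hu
  simp only [Function.comp_apply]
  set k := ψ n with hk
  have hclose : d.rd (φ k z) y < δ := hψδ n
  have hyc_low : 1 / (2 * M) ≤ d.rd y (c (a k)) := by
    have h := d.rd_triangle hrem (hy k).1 hyω (hne (a k))
    have h' := hy_low k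
    have : 1 / M = 1 / (2 * M) + 1 / (2 * M) := by field_simp; norm_num
    linarith
  have hyc_pos : 0 < d.rd y (c (a k)) := lt_of_lt_of_le (by positivity) hyc_low
  have hyc : y ≠ c (a k) := by
    intro e
    rw [← e, ExtMetric.rd, d.d_self, ENNReal.toReal_zero] at hyc_pos
    exact lt_irrefl _ hyc_pos
  obtain ⟨hw1, hw2, hw3⟩ := hφ k y hyω hyc
  have hwz : d.rd (φ k y) z ≤ β / 4 := by
    have h := hφd k y (φ k z) hyω hyc (hy k).1 (hy k).2.1
    rw [hinv k z, d.rd_comm y (φ k z)] at h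
    have hprod : 1 / (2 * M) * (1 / M) ≤ d.rd y (c (a k)) * d.rd (φ k z) (c (a k)) :=
      mul_le_mul hyc_low (hy_low k) (by positivity) hyc_pos.le
    have h5 := mul_le_mul_of_nonneg_left hprod (d.rd_nonneg (φ k y) z)
    have h6 : d.rd (φ k y) z * (1 / (2 * M) * (1 / M)) ≤ β / 4 * (1 / (2 * M) * (1 / M)) := by
      have : β / 4 * (1 / (2 * M) * (1 / M)) = β / (8 * M ^ 2) := by field_simp; norm_num
      linarith
    exact le_of_mul_le_mul_right h6 (by positivity)
  have hw_dist : ∀ t, d.rd z (c t) - β / 4 ≤ d.rd (φ k y) (c t) := by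
    intro t
    have := d.rd_triangle hrem hz hw1 (hne t)
    rw [d.rd_comm z (φ k y)] at this
    linarith
  have hline : ∀ v ≠ 0, d.rd y (c (a k - 1 / v)) =
      d.rd (φ k y) (c (a k + v)) * d.rd y (c (a k)) / |v| := by
    intro v hv
    have hcv : c (a k + v) ≠ c (a k) := fun e => hv (by simpa using hc.injective e)
    have h := hφd k (φ k y) (c (a k + v)) hw1 hw2 (hne _) hcv
    rw [hinv k y, hφc k v hv, hc.rd_eq, add_sub_cancel_left] at h
    rw [eq_div_iff (abs_pos.mpr hv).ne', ← h]
    linear_combination -(d.rd y (c (a k - 1 / v)) * |v|) * hw3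
  have hminus := hline (1 / u) (by positivity)
  have hplus := hline (-(1 / u)) (neg_ne_zero.mpr (by positivity))
  rw [abs_neg] at hplus
  rw [abs_of_pos (by positivity)] at hplus hminus
  have e1 : a k - 1 / (1 / u) = a k - u := by rw [one_div_one_div]
  have e2 : a k - 1 / -(1 / u) = a k + u := by rw [one_div_neg_eq_neg_one_div]; simp
  rw [e1] at hminus
  rw [e2, ← sub_eq_add_neg] at hplus
  rw [hminus, hplus]
  have hS := hshift (a k) (1 / u)
  have hA := hw_dist (a k + 1 / u)
  have hB := hw_dist (a k - 1 / u)
  have hsum : 2 * (1 / u) + β / 2 ≤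
      d.rd (φ k y) (c (a k - 1 / u)) + d.rd (φ k y) (c (a k + 1 / u)) := by linarith
  have hmul := mul_le_mul_of_nonneg_right hsum (mul_pos hyc_pos hu).le
  have hlast : β / (4 * M) * u ≤ β / 2 * (d.rd y (c (a k)) * u) := by
    have := mul_le_mul_of_nonneg_right (mul_le_mul_of_nonneg_left hyc_low (half_pos hβ).le) hu.le
    calc β / (4 * M) * u = β / 2 * (1 / (2 * M)) * u := by field_simp; norm_num
      _ ≤ _ := this
      _ = _ := by ring
  have hu2 : 2 * (1 / u) * (d.rd y (c (a k)) * u) = 2 * d.rd y (c (a k)) := by field_simp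
  simp only [div_div_eq_mul_div, div_one]
  linarith

end Flatness

/-- A function all of whose chords lie on its graph is affine. -/
theorem exists_affine_of_chord {f : ℝ → ℝ}
    (h : ∀ s m t, s < m → m < t → (t - s) * f m = (t - m) * f s + (m - s) * f t) :
    ∃ α β : ℝ, ∀ t, f t = α * t + β := by
  refine ⟨f 1 - f 0, f 0, fun t => ?_⟩
  rcases lt_trichotomy t 0 with ht | rfl | ht
  · linarith [h t 0 1 ht one_pos]
  · simp
  · rcases lt_trichotomy t 1 with ht1 | rfl | ht1
    · linarith [h 0 t 1 ht ht1]
    · simp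
    · linarith [h 0 1 t one_pos ht1]

/-- Limits of distance functions, shifted by constants, are convex along geodesic lines. -/
theorem IsPtolemyStructure.convex_of_tendsto {X : Type*} {S : MobiusStructure X}
    {d : ExtMetric X} {ω : X} (hpt : IsPtolemyStructure S) (hd : d ∈ S.M)
    (hrem : d.rem = some ω) {l : Set X} {c : ℝ → X} (hc : IsUnitSpeed d l c) (hl : ω ∉ l)
    {p : ℝ → X} (hp : ∀ u, p u ≠ ω) {b : X → ℝ}
    (hb : ∀ x, x ≠ ω → Filter.Tendsto (fun u => d.rd x (p u) - u) Filter.atTop (nhds (b x)))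
    {s m t : ℝ} (hsm : s < m) (hmt : m < t) :
    (t - s) * b (c m) ≤ (t - m) * b (c s) + (m - s) * b (c t) := by
  have hne := hc.ne_remote hl
  refine le_of_tendsto_of_tendsto' ((hb _ (hne m)).const_mul (t - s))
    (((hb _ (hne s)).const_mul (t - m)).add ((hb _ (hne t)).const_mul (m - s))) fun u => ?_
  have := hpt.rd_convex hd hrem hc hl (hp u) hsm hmt
  rw [d.rd_comm (p u), d.rd_comm (p u), d.rd_comm (p u)] at this
  linarith

/-- Proposition 6.3 of the paper.  Let `X` be a compact Ptolemy space
with properties (E) and (I) and `ω ∈ X`.  Then for any two Ptolemy lines `l, l' ⊆ X_ω`,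
every Busemann function of `l` is affine along `l'`: for every unit-speed
parameterization `c'` of `l'` there are `α, β ∈ ℝ` with `b(c'(t)) = α·t + β` for all
`t ∈ ℝ`. -/
theorem stmt_10 {X : Type*} (S : MobiusStructure X)
    (hpt : IsPtolemyStructure S) (hcomp : MobiusCompact S)
    (hE : PropertyE S) (hI : PropertyI S)
    (ω : X) (d : ExtMetric X) (hd : d ∈ S.M) (hrem : d.rem = some ω)
    (l l' : Set X) (hl' : IsPtolemyLine S ω l')
    (b : X → ℝ) (hb : IsBusemannOf S d ω l b)
    (c' : ℝ → X) (hc' : IsUnitSpeed d l' c') :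
    ∃ α β : ℝ, ∀ t : ℝ, b (c' t) = α * t + β := by
  obtain ⟨hl, c, hc, C, hbC⟩ := hb
  have hωl : ω ∉ l := by
    obtain ⟨σ, -, -, rfl⟩ := hl
    exact fun h => h.2 rfl
  have hωl' : ω ∉ l' := by
    obtain ⟨σ, -, -, rfl⟩ := hl'
    exact fun h => h.2 rfl
  have hne := hc.ne_remote hωl
  have hplus : ∀ x, x ≠ ω →
      Filter.Tendsto (fun t => d.rd x (c t) - t) Filter.atTop (nhds (b x + C)) := hbC
  have hflat : ∀ x, x ≠ ω → Filter.Tendsto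
      (fun t => d.rd x (c t) + d.rd x (c (-t)) - 2 * t) Filter.atTop (nhds 0) := by
    intro x hx
    rw [Metric.tendsto_atTop]
    intro ε hε
    obtain ⟨T, hT⟩ := busemann_flat hpt hcomp hI hd hrem hl hc hx hε
    refine ⟨max T 0, fun t ht => ?_⟩
    have htT : T ≤ t := (le_max_left _ _).trans ht
    have ht0 : 0 ≤ t := (le_max_right _ _).trans ht
    have h1 := d.rd_triangle hrem hx (hne T) (hne t)
    have h2 := d.rd_triangle hrem hx (hne (-T)) (hne (-t))
    have h3 := d.rd_triangle hrem (hne t) hx (hne (-t))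
    rw [hc.rd_eq, abs_of_nonpos (by linarith)] at h1
    rw [hc.rd_eq, abs_of_nonneg (by linarith)] at h2
    rw [hc.rd_eq, abs_of_nonneg (by linarith), d.rd_comm (c t)] at h3
    rw [Real.dist_eq, sub_zero, abs_of_nonneg (by linarith)]
    linarith
  have hminus : ∀ x, x ≠ ω →
      Filter.Tendsto (fun t => d.rd x (c (-t)) - t) Filter.atTop (nhds (-(b x + C))) := by
    intro x hx
    have h := (hflat x hx).sub (hplus x hx)
    rw [zero_sub] at h
    exact h.congr fun t => by ring
  refine exists_affine_of_chord fun s m t hsm hmt => le_antisymm ?_ ?_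
  · have := hpt.convex_of_tendsto hd hrem hc' hωl' hne (b := fun x => b x + C) hplus hsm hmt
    linarith
  · have := hpt.convex_of_tendsto hd hrem hc' hωl' (fun u => hne (-u))
      (b := fun x => -(b x + C)) hminus hsm hmt
    linarith

end Mobius
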